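/- (Proposition 3.2.) Let J_l := {g *_λ x^n : g ∈ ℝ[x,p]} and N_l := {f ∈ ℝ[x,p] : x^n *_λ f ∈ J_l}. An element h = Σ_{i=0}^{n−1} h_i *_λ x^i with h_i ∈ ℝ[p] lies in N_l if and only if there exist constants a_{i,k} ∈ ℝ, 0 ≤ i,k ≤ n−1, such that for each i, h_i = Σ_{k=0}^{n−1} a_{i,k} p^k + (1/(2λ)^i) Σ_{k=0}^{i−1} ((2λ)^k/(i−k)!) Σ_{j=0}^{i−k−1} (−1)^{j+1} C(i−k−1, j) a_{k, n−i+k+j} p^{n+j}. Hence every residue class in N_l/J_l has a representative of this form, with the constants a_{i,k} uniquely determined. -/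

import Mathlib

/- The Moyal product on ℝ[x,p], where x = X 0 and p = X 1 in `MvPolynomial (Fin 2) ℝ`:
   f *_λ g := Σ_{i=0}^∞ (λ^i/i!) Σ_{k=0}^i C(i,k) (−1)^k (∂_x^{i−k}∂_p^k f)·(∂_x^k ∂_p^{i−k} g).
   On polynomials only finitely many terms are nonzero, so the `finsum` below is faithful. -/

open MvPolynomial

/-- Differentiation with respect to x (the variable `X 0`). -/
noncomputable def dX : MvPolynomial (Fin 2) ℝ → MvPolynomial (Fin 2) ℝ :=
  fun f => pderiv (0 : Fin 2) f

/-- Differentiation with respect to p (the variable `X 1`). -/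
noncomputable def dP : MvPolynomial (Fin 2) ℝ → MvPolynomial (Fin 2) ℝ :=
  fun f => pderiv (1 : Fin 2) f

/-- The Moyal star product with deformation parameter `lam`. -/
noncomputable def moyal (lam : ℝ) (f g : MvPolynomial (Fin 2) ℝ) : MvPolynomial (Fin 2) ℝ :=
  ∑ᶠ i : ℕ, (lam ^ i / (i.factorial : ℝ)) •
    ∑ k ∈ Finset.range (i + 1),
      ((i.choose k : ℝ) * (-1 : ℝ) ^ k) • (dX^[i - k] (dP^[k] f) * dX^[k] (dP^[i - k] g))

/-- The inclusion of polynomials in the single variable p into ℝ[x,p]. -/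
noncomputable def toMv (q : Polynomial ℝ) : MvPolynomial (Fin 2) ℝ :=
  Polynomial.aeval (X 1 : MvPolynomial (Fin 2) ℝ) q

/-- The left ideal J_l = ℝ[x,p] *_λ x^n. -/
def Jl (lam : ℝ) (n : ℕ) : Set (MvPolynomial (Fin 2) ℝ) :=
  {f | ∃ g : MvPolynomial (Fin 2) ℝ, f = moyal lam g (X 0 ^ n)}

/-- The normalizer N_l = {f : x^n *_λ f ∈ J_l}. -/
def Nl (lam : ℝ) (n : ℕ) : Set (MvPolynomial (Fin 2) ℝ) :=
  {f | moyal lam (X 0 ^ n) f ∈ Jl lam n}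

/-- The explicit family of polynomials of Proposition 3.2:
h_i = Σ_{k=0}^{n−1} a_{i,k} p^k + (1/(2λ)^i) Σ_{k=0}^{i−1} ((2λ)^k/(i−k)!)
      Σ_{j=0}^{i−k−1} (−1)^{j+1} C(i−k−1, j) a_{k, n−i+k+j} p^{n+j}. -/
noncomputable def Hpoly (lam : ℝ) (n : ℕ) (a : ℕ → ℕ → ℝ) (i : ℕ) : Polynomial ℝ :=
  (∑ k ∈ Finset.range n, Polynomial.C (a i k) * Polynomial.X ^ k) +
    (1 / (2 * lam) ^ i) •
      ∑ k ∈ Finset.range i, ((2 * lam) ^ k / ((i - k).factorial : ℝ)) •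
        ∑ j ∈ Finset.range (i - k),
          Polynomial.C ((-1 : ℝ) ^ (j + 1) * ((i - k - 1).choose j : ℝ) * a k (n - i + k + j)) *
            Polynomial.X ^ (n + j)

/-- The operator `f ↦ x f + c ∂_p f`; left and right star multiplication by `x` are the cases
`c = lam` and `c = -lam`. -/
noncomputable def starX (c : ℝ) : Module.End ℝ (MvPolynomial (Fin 2) ℝ) :=
  LinearMap.mulLeft ℝ (X 0) + c • (pderiv (1 : Fin 2)).toLinearMap

lemma starX_apply (c : ℝ) (f : MvPolynomial (Fin 2) ℝ) :
    starX c f = X 0 * f + c • pderiv 1 f := rfl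

lemma commute_mulLeft_pderiv :
    Commute (LinearMap.mulLeft ℝ (X 0 : MvPolynomial (Fin 2) ℝ))
      (pderiv (1 : Fin 2)).toLinearMap := by
  apply LinearMap.ext
  intro f
  simp [pderiv_X]

lemma commute_starX_pderiv (c : ℝ) :
    Commute (starX c) (pderiv (1 : Fin 2)).toLinearMap :=
  commute_mulLeft_pderiv.add_left ((Commute.refl _).smul_left c)

lemma commute_starX (c c' : ℝ) : Commute (starX c) (starX c') := by
  have h : starX c' = starX c + (c' - c) • (pderiv (1 : Fin 2)).toLinearMap := by
    simp only [starX]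
    module
  rw [h]
  exact (Commute.refl _).add_right ((commute_starX_pderiv c).smul_right _)

lemma dX_iterate_X_pow (m i : ℕ) :
    dX^[m] (X 0 ^ i) = (i.descFactorial m : ℝ) • X 0 ^ (i - m) := by
  induction m with
  | zero => simp
  | succ m ih =>
    rw [Function.iterate_succ_apply', ih, dX, Derivation.map_smul, pderiv_pow, pderiv_X_self,
      Nat.descFactorial_succ, mul_one, Nat.sub_sub, Nat.cast_mul, mul_smul, smul_comm,
      ← nsmul_eq_mul]
    simp only [Nat.cast_smul_eq_nsmul]

lemma dX_iterate_dP_iterate_X_pow (k m i : ℕ) (hm : m ≠ 0) : dX^[k] (dP^[m] (X 0 ^ i)) = 0 := by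
  have hX (k : ℕ) : dX^[k] 0 = 0 := Function.iterate_fixed (by simp [dX]) k
  have hP (k : ℕ) : dP^[k] 0 = 0 := Function.iterate_fixed (by simp [dP]) k
  obtain ⟨m, rfl⟩ := Nat.exists_eq_succ_of_ne_zero hm
  have h : dP (X 0 ^ i) = 0 := by simp [dP, pderiv_X]
  rw [Function.iterate_succ_apply, h, hP, hX]

lemma starX_pow_apply (c : ℝ) (i : ℕ) (f : MvPolynomial (Fin 2) ℝ) :
    (starX c ^ i) f = ∑ m ∈ Finset.range (i + 1),
      (c ^ m / (m.factorial : ℝ)) • (dP^[m] f * dX^[m] (X 0 ^ i)) := by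
  have hcomm := (commute_mulLeft_pderiv.smul_right c).symm
  rw [starX, add_comm, hcomm.add_pow, LinearMap.sum_apply]
  refine Finset.sum_congr rfl fun m _ => ?_
  have hP : ((pderiv (1 : Fin 2)).toLinearMap ^ m : Module.End ℝ (MvPolynomial (Fin 2) ℝ)) f
      = dP^[m] f := by
    rw [Module.End.pow_apply]; rfl
  rw [← (Nat.cast_commute (i.choose m) _).eq, smul_pow, ← nsmul_eq_mul, LinearMap.smul_apply,
    smul_mul_assoc, LinearMap.smul_apply, (commute_mulLeft_pderiv.pow_pow _ _).symm.eq,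
    Module.End.mul_apply, hP, LinearMap.pow_mulLeft, LinearMap.mulLeft_apply,
    dX_iterate_X_pow, Nat.descFactorial_eq_factorial_mul_choose, mul_smul_comm, smul_smul,
    ← Nat.cast_smul_eq_nsmul ℝ, smul_smul, mul_comm (dP^[m] f)]
  congr 1
  have := m.factorial_ne_zero
  push_cast
  field_simp

lemma finsum_star_eq (c : ℝ) (i : ℕ) (f : MvPolynomial (Fin 2) ℝ) :
    ∑ᶠ m : ℕ, (c ^ m / (m.factorial : ℝ)) • (dP^[m] f * dX^[m] (X 0 ^ i)) = (starX c ^ i) f := by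
  rw [starX_pow_apply]
  refine finsum_eq_finsetSum_of_support_subset _ fun m hm => ?_
  by_contra h
  have : i < m := by simpa using h
  exact hm (by simp [dX_iterate_X_pow, Nat.descFactorial_of_lt this])

lemma moyal_X_pow_right (lam : ℝ) (f : MvPolynomial (Fin 2) ℝ) (i : ℕ) :
    moyal lam f (X 0 ^ i) = (starX (-lam) ^ i) f := by
  rw [← finsum_star_eq, moyal]
  refine finsum_congr fun m => ?_
  rw [Finset.sum_eq_single_of_mem m (by simp)]
  · simp only [Nat.sub_self, Function.iterate_zero_apply, Nat.choose_self, Nat.cast_one, one_mul,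
      smul_smul]
    congr 1
    rw [neg_pow]
    ring
  · intro k hk hkm
    have := Finset.mem_range.1 hk
    rw [dX_iterate_dP_iterate_X_pow _ _ _ (by lia), mul_zero, smul_zero]

lemma moyal_X_pow_left (lam : ℝ) (f : MvPolynomial (Fin 2) ℝ) (i : ℕ) :
    moyal lam (X 0 ^ i) f = (starX lam ^ i) f := by
  rw [← finsum_star_eq, moyal]
  refine finsum_congr fun m => ?_
  rw [Finset.sum_eq_single_of_mem 0 (by simp)]
  · simp [mul_comm]
  · intro k hk hkm
    rw [dX_iterate_dP_iterate_X_pow _ _ _ hkm, zero_mul, smul_zero]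

lemma toMv_add (q r : Polynomial ℝ) : toMv (q + r) = toMv q + toMv r := map_add _ _ _

lemma toMv_sub (q r : Polynomial ℝ) : toMv (q - r) = toMv q - toMv r := map_sub _ _ _

lemma toMv_smul (c : ℝ) (q : Polynomial ℝ) : toMv (c • q) = c • toMv q := map_smul _ _ _

lemma toMv_sum {ι : Type*} (s : Finset ι) (q : ι → Polynomial ℝ) :
    toMv (∑ i ∈ s, q i) = ∑ i ∈ s, toMv (q i) := map_sum _ _ _

lemma pderiv_one_toMv (q : Polynomial ℝ) : pderiv 1 (toMv q) = toMv q.derivative := by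
  rw [toMv, Derivation.map_aeval, pderiv_X_self, smul_eq_mul, mul_one, toMv]

lemma pderiv_zero_toMv (q : Polynomial ℝ) : pderiv 0 (toMv q) = 0 := by
  rw [toMv, Derivation.map_aeval, pderiv_X_of_ne (by decide), smul_zero]

lemma pderiv_pow_toMv (m : ℕ) (q : Polynomial ℝ) :
    ((pderiv (1 : Fin 2)).toLinearMap ^ m : Module.End ℝ (MvPolynomial (Fin 2) ℝ)) (toMv q) =
      toMv (Polynomial.derivative^[m] q) := by
  induction m with
  | zero => simp
  | succ m ih =>
    rw [pow_succ', Module.End.mul_apply, ih, Function.iterate_succ_apply', ← pderiv_one_toMv]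
    rfl

lemma toMv_injective : Function.Injective toMv := by
  have h (q : Polynomial ℝ) :
      MvPolynomial.aeval (fun _ : Fin 2 => (Polynomial.X : Polynomial ℝ)) (toMv q) = q := by
    rw [toMv, ← Polynomial.aeval_algHom_apply, MvPolynomial.aeval_X, Polynomial.aeval_X_left,
      AlgHom.id_apply]
  exact Function.LeftInverse.injective h

lemma exists_eq_toMv_add_starX (c : ℝ) (f : MvPolynomial (Fin 2) ℝ) :
    ∃ q g, f = toMv q + starX c g := by
  have key (a : ℕ) : ∀ q, ∃ r g, X 0 ^ a * toMv q = toMv r + starX c g := by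
    induction a with
    | zero => exact fun q => ⟨q, 0, by simp⟩
    | succ a ih =>
      intro q
      obtain ⟨r, g, h⟩ := ih q.derivative
      refine ⟨-c • r, X 0 ^ a * toMv q - c • g, ?_⟩
      have hd : pderiv 1 (X 0 ^ a * toMv q) = toMv r + starX c g := by
        rw [← h, pderiv_mul, pderiv_one_toMv, pderiv_pow, pderiv_X_of_ne (by decide)]
        simp
      rw [map_sub, map_smul, starX_apply c (X 0 ^ a * toMv q), hd, toMv_smul, smul_add, pow_succ',
        mul_assoc]
      module
  induction f using MvPolynomial.induction_on' with
  | monomial u a =>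
    obtain ⟨r, g, h⟩ := key (u 0) (Polynomial.C a * Polynomial.X ^ u 1)
    refine ⟨r, g, h ▸ ?_⟩
    rw [monomial_eq, Finsupp.prod_fintype _ _ (by simp), Fin.prod_univ_two, toMv]
    simp [algebraMap_eq]
    ring
  | add p q hp hq =>
    obtain ⟨r, g, h⟩ := hp
    obtain ⟨r', g', h'⟩ := hq
    exact ⟨r + r', g + g', by rw [h, h', toMv_add, map_add]; abel⟩

lemma coeff_toMv_add_single (m : Fin 2 →₀ ℕ) (q : Polynomial ℝ) :
    coeff (m + Finsupp.single 0 1) (toMv q) = 0 := by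
  have h := congrArg (coeff m) (pderiv_zero_toMv q)
  rw [coeff_pderiv, coeff_zero] at h
  exact (mul_eq_zero.1 h).resolve_right (by positivity)

lemma eq_zero_of_toMv_add_starX_eq_zero (c : ℝ) {q : Polynomial ℝ} {g : MvPolynomial (Fin 2) ℝ}
    (h : toMv q + starX c g = 0) : q = 0 ∧ g = 0 := by
  have hrec (m : Fin 2 →₀ ℕ) (hm : coeff (m + Finsupp.single 0 1 + Finsupp.single 1 1) g = 0) :
      coeff m g = 0 := by
    have h' := congrArg (coeff (m + Finsupp.single 0 1)) h
    rw [starX_apply, coeff_add, coeff_add, coeff_toMv_add_single, coeff_smul, coeff_pderiv, hm,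
      add_comm m, coeff_X_mul] at h'
    simpa using h'
  have hg : g = 0 := by
    have hk (k : ℕ) : ∀ m : Fin 2 →₀ ℕ, g.totalDegree < m.degree + k → coeff m g = 0 := by
      induction k with
      | zero => exact fun m hm => coeff_eq_zero_of_totalDegree_lt hm
      | succ k ih =>
        refine fun m hm => hrec m (ih _ ?_)
        simp only [map_add, Finsupp.degree_single]
        lia
    ext m
    exact hk (g.totalDegree + 1) m (by lia)
  subst hg
  refine ⟨toMv_injective ?_, rfl⟩
  simpa [toMv] using h

lemma exists_eq_sum_starX_pow (c : ℝ) (n : ℕ) (f : MvPolynomial (Fin 2) ℝ) :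
    ∃ (h : ℕ → Polynomial ℝ) (g : MvPolynomial (Fin 2) ℝ),
      f = ∑ i ∈ Finset.range n, (starX c ^ i) (toMv (h i)) + (starX c ^ n) g := by
  induction n with
  | zero => exact ⟨0, f, by simp⟩
  | succ n ih =>
    obtain ⟨h, g, hf⟩ := ih
    obtain ⟨q, g', rfl⟩ := exists_eq_toMv_add_starX c g
    refine ⟨Function.update h n q, g', ?_⟩
    rw [hf, Finset.sum_range_succ, Function.update_self, map_add, pow_succ, Module.End.mul_apply,
      add_assoc]
    congr 1
    refine Finset.sum_congr rfl fun i hi => ?_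
    rw [Function.update_of_ne (Finset.mem_range.1 hi).ne]

lemma eq_zero_of_sum_starX_pow_eq_zero (c : ℝ) (n : ℕ) : ∀ (h : ℕ → Polynomial ℝ)
    (g : MvPolynomial (Fin 2) ℝ),
    ∑ i ∈ Finset.range n, (starX c ^ i) (toMv (h i)) + (starX c ^ n) g = 0 →
      ∀ i < n, h i = 0 := by
  induction n with
  | zero => simp
  | succ n ih =>
    intro h g hs
    have h0 : toMv (h 0) + starX c (∑ i ∈ Finset.range n, (starX c ^ i) (toMv (h (i + 1))) +
        (starX c ^ n) g) = 0 := by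
      rw [← hs, Finset.sum_range_succ', map_add, map_sum]
      simp only [pow_succ' (starX c), Module.End.mul_apply, pow_zero, Module.End.one_apply]
      abel
    obtain ⟨hz, hs'⟩ := eq_zero_of_toMv_add_starX_eq_zero c h0
    rintro (_ | i) hi
    · exact hz
    · exact ih (fun i => h (i + 1)) g hs' i (by lia)

lemma mem_Jl_iff (lam : ℝ) (n : ℕ) (f : MvPolynomial (Fin 2) ℝ) :
    f ∈ Jl lam n ↔ f ∈ LinearMap.range (starX (-lam) ^ n) := by
  simp only [Jl, Set.mem_ofPred_eq, moyal_X_pow_right, LinearMap.mem_range, eq_comm]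

lemma sum_starX_pow_mem_Jl_iff (lam : ℝ) (n : ℕ) (h : ℕ → Polynomial ℝ) :
    ∑ i ∈ Finset.range n, (starX (-lam) ^ i) (toMv (h i)) ∈ Jl lam n ↔ ∀ i < n, h i = 0 := by
  rw [mem_Jl_iff]
  constructor
  · rintro ⟨g, hg⟩
    refine eq_zero_of_sum_starX_pow_eq_zero (-lam) n h (-g) ?_
    rw [map_neg, hg, add_neg_cancel]
  · intro hz
    rw [Finset.sum_eq_zero fun i hi => by rw [hz i (Finset.mem_range.1 hi)]; simp [toMv]]
    exact zero_mem _

/-- The coefficient of `x^s` in the expansion of `x^n * ∑ h_i * x^i`, as a polynomial in `p`. -/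
noncomputable def starCoeff (lam : ℝ) (n : ℕ) (h : ℕ → Polynomial ℝ) (s : ℕ) : Polynomial ℝ :=
  ∑ i ∈ Finset.range (s + 1), ((n.choose (s - i) : ℝ) * (2 * lam) ^ (n - (s - i))) •
    Polynomial.derivative^[n - (s - i)] (h i)

lemma starX_pow_starX_pow_toMv (lam : ℝ) (n i : ℕ) (q : Polynomial ℝ) :
    (starX lam ^ n) ((starX (-lam) ^ i) (toMv q)) = ∑ m ∈ Finset.range (n + 1),
      (starX (-lam) ^ (i + m)) (toMv (((n.choose m : ℝ) * (2 * lam) ^ (n - m)) •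
        Polynomial.derivative^[n - m] q)) := by
  have hL : starX lam = starX (-lam) + (2 * lam) • (pderiv (1 : Fin 2)).toLinearMap := by
    simp only [starX]
    module
  have hc := (commute_starX_pderiv (-lam)).smul_right (2 * lam)
  rw [hL, hc.add_pow, LinearMap.sum_apply]
  refine Finset.sum_congr rfl fun m _ => ?_
  rw [← (Nat.cast_commute (n.choose m) _).eq, smul_pow, ← nsmul_eq_mul, LinearMap.smul_apply,
    mul_smul_comm, LinearMap.smul_apply, Module.End.mul_apply, ← Module.End.mul_apply _ (_ ^ i),
    ((commute_starX_pderiv (-lam)).symm.pow_pow _ _).eq, Module.End.mul_apply, pderiv_pow_toMv,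
    ← Module.End.mul_apply, ← pow_add, add_comm m, toMv_smul, map_smul,
    ← Nat.cast_smul_eq_nsmul ℝ, smul_smul]

lemma sum_moyal_mem_Nl_iff (lam : ℝ) (n : ℕ) (h : ℕ → Polynomial ℝ) :
    (∑ i ∈ Finset.range n, moyal lam (toMv (h i)) (X 0 ^ i)) ∈ Nl lam n ↔
      ∀ s < n, starCoeff lam n h s = 0 := by
  rw [← sum_starX_pow_mem_Jl_iff lam n (starCoeff lam n h), Nl, Set.mem_ofPred_eq,
    moyal_X_pow_left, mem_Jl_iff, mem_Jl_iff, map_sum]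
  simp only [moyal_X_pow_right, starX_pow_starX_pow_toMv]
  set F : ℕ → ℕ → MvPolynomial (Fin 2) ℝ := fun i m =>
    (starX (-lam) ^ (i + m)) (toMv (((n.choose m : ℝ) * (2 * lam) ^ (n - m)) •
        Polynomial.derivative^[n - m] (h i))) with hF
  have hlow : ∑ s ∈ Finset.range n, (starX (-lam) ^ s) (toMv (starCoeff lam n h s)) =
      ∑ i ∈ Finset.range n, ∑ m ∈ Finset.range (n - i), F i m := by
    rw [← Finset.sum_range_diag_flip]
    refine Finset.sum_congr rfl fun s _ => ?_
    rw [starCoeff, toMv_sum, map_sum]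
    refine Finset.sum_congr rfl fun i hi => ?_
    rw [hF]
    simp only
    rw [Nat.add_sub_cancel' (by have := Finset.mem_range.1 hi; lia)]
  have hsplit : ∑ i ∈ Finset.range n, ∑ m ∈ Finset.range (n + 1), F i m =
      ∑ i ∈ Finset.range n, ∑ m ∈ Finset.range (n - i), F i m +
        ∑ i ∈ Finset.range n, ∑ m ∈ Finset.range (i + 1), F i (n - i + m) := by
    rw [← Finset.sum_add_distrib]
    refine Finset.sum_congr rfl fun i hi => ?_
    rw [← Finset.sum_range_add, show n - i + (i + 1) = n + 1 by
      have := Finset.mem_range.1 hi; lia]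
  rw [hlow, hsplit]
  refine Submodule.add_mem_iff_left _ (Submodule.sum_mem _ fun i hi => Submodule.sum_mem _
    fun m _ => ?_)
  have : i + (n - i + m) = n + m := by have := Finset.mem_range.1 hi; lia
  rw [hF]
  simp only
  rw [this, pow_add, Module.End.mul_apply]
  exact LinearMap.mem_range_self _ _

lemma sum_neg_one_pow_mul_choose_mul_eval_eq_zero {n : ℕ} (Q : Polynomial ℝ)
    (hQ : Q.natDegree < n) (y : ℝ) :
    ∑ k ∈ Finset.range (n + 1), (-1 : ℝ) ^ k * n.choose k * Q.eval (y - k) = 0 := by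
  have h := congrFun (Polynomial.fwdDiff_iter_eq_zero_of_degree_lt hQ) (y - n)
  rw [fwdDiff_iter_eq_sum_shift, ← Finset.sum_range_reflect] at h
  rw [← Pi.zero_apply (M := fun _ : ℝ => ℝ) (y - n), ← h]
  refine Finset.sum_congr rfl fun k hk => ?_
  have hk' : k ≤ n := by have := Finset.mem_range.1 hk; lia
  have h1 : n + 1 - 1 - k = n - k := by lia
  rw [h1, Nat.sub_sub_self hk', Nat.choose_symm hk', zsmul_eq_mul, nsmul_eq_mul, Nat.cast_sub hk']
  push_cast
  congr 2
  ring

/-- The coefficient of `p^(n-r+d)` contributed to `(2λ)^(k+d) h_(k+d)` by the monomial `p^(n-r)` of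
`(2λ)^k h_k`. -/
noncomputable def liftCoeff (d r : ℕ) : ℝ :=
  (-1) ^ (d + r + 1) / (d.factorial * (r - 1).factorial) *
    (descPochhammer ℝ (r - 1)).eval ((d : ℝ) - 1)

lemma liftCoeff_zero {r : ℕ} (hr : r ≠ 0) : liftCoeff 0 r = 1 := by
  obtain ⟨r, rfl⟩ := Nat.exists_eq_succ_of_ne_zero hr
  have h : (descPochhammer ℝ r).eval (-1 : ℝ) = (-1) ^ r * r.factorial := by
    have h1 := ascPochhammer_eval_neg_eq_descPochhammer ℝ (-1) r
    rw [neg_neg, ascPochhammer_eval_one] at h1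
    rw [h1, ← mul_assoc, ← mul_pow, neg_one_mul, neg_neg, one_pow, one_mul]
  have := r.factorial_ne_zero
  simp only [liftCoeff, Nat.succ_eq_add_one, Nat.add_sub_cancel, Nat.cast_zero, zero_sub, h]
  field_simp
  rw [← pow_add, Nat.factorial_zero, Nat.cast_one]
  exact Even.neg_one_pow (by grind)

lemma liftCoeff_succ (d r : ℕ) :
    liftCoeff (d + 1) (r + 1) = (-1) ^ (d + r + 1) * d.choose r / (d + 1).factorial := by
  have h : (descPochhammer ℝ r).eval (d : ℝ) = d.choose r * r.factorial := by
    rw [descPochhammer_eval_eq_descFactorial, Nat.descFactorial_eq_factorial_mul_choose]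
    push_cast
    ring
  have := r.factorial_ne_zero
  simp only [liftCoeff, Nat.add_sub_cancel, Nat.cast_add, Nat.cast_one, add_sub_cancel_right, h]
  field_simp
  ring

lemma sum_choose_mul_liftCoeff {n l s : ℕ} (hs : s < n) (hl : l < n) (hsl : n ≤ l + s) :
    ∑ d ∈ Finset.range (s + 1),
      (n.choose (s - d) : ℝ) * liftCoeff d (n - l) * (l + d).factorial = 0 := by
  set r := n - l - 1 with hr
  set Q : Polynomial ℝ := (ascPochhammer ℝ l).comp (Polynomial.X + 1) *
    (descPochhammer ℝ r).comp (Polynomial.X - 1) with hQ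
  have hdeg : Q.natDegree < n := by
    refine Polynomial.natDegree_mul_le.trans_lt ?_
    rw [Polynomial.natDegree_comp, Polynomial.natDegree_comp, ascPochhammer_natDegree,
      descPochhammer_natDegree, ← Polynomial.C_1, Polynomial.natDegree_X_add_C,
      Polynomial.natDegree_X_sub_C]
    lia
  have h := sum_neg_one_pow_mul_choose_mul_eval_eq_zero Q hdeg s
  rw [show n + 1 = (s + 1) + (n - s) by lia, Finset.sum_range_add,
    Finset.sum_eq_zero (s := Finset.range (n - s)), add_zero, ← Finset.sum_range_reflect] at h
  · have h2 := congrArg (fun z => z * ((-1 : ℝ) ^ (s + n - l + 1) / r.factorial)) h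
    simp only [zero_mul, Finset.sum_mul] at h2
    rw [← h2]
    refine Finset.sum_congr rfl fun d hd => ?_
    have hd' : d ≤ s := by have := Finset.mem_range.1 hd; lia
    have hval : (ascPochhammer ℝ l).eval ((d : ℝ) + 1) = (l + d).factorial / d.factorial := by
      rw [eq_div_iff (by positivity), mul_comm, factorial_mul_ascPochhammer, add_comm]
    have e1 : s + 1 - 1 - d = s - d := by lia
    rw [e1, hQ, liftCoeff, ← hr, Nat.cast_sub hd', sub_sub_cancel, Polynomial.eval_mul,
      Polynomial.eval_comp, Polynomial.eval_comp]
    simp only [Polynomial.eval_add, Polynomial.eval_sub, Polynomial.eval_X, Polynomial.eval_one,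
      hval]
    have hsign : (-1 : ℝ) ^ (d + (n - l) + 1) = (-1) ^ (s - d) * (-1) ^ (s + n - l + 1) := by
      rw [← pow_add]
      refine neg_one_pow_congr ?_
      grind
    rw [hsign]
    field_simp
  · intro k hk
    have hk' := Finset.mem_range.1 hk
    have h0 : (ascPochhammer ℝ l).eval ((s : ℝ) - ((s + 1 + k : ℕ) : ℝ) + 1) = 0 := by
      rw [show (s : ℝ) - ((s + 1 + k : ℕ) : ℝ) + 1 = -(k : ℝ) by push_cast; ring]
      exact ascPochhammer_eval_neg_coe_nat_of_lt (by lia)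
    rw [hQ, Polynomial.eval_mul, Polynomial.eval_comp]
    simp only [Polynomial.eval_add, Polynomial.eval_X, Polynomial.eval_one, h0]
    ring

lemma sum_liftCoeff_smul_iterate_derivative {n l s : ℕ} (hs : s < n) (hl : l < n) :
    ∑ d ∈ Finset.range (s + 1), ((n.choose (s - d) : ℝ) * liftCoeff d (n - l)) •
      Polynomial.derivative^[n - (s - d)] (Polynomial.X ^ (l + d) : Polynomial ℝ) = 0 := by
  by_cases hsl : n ≤ l + s
  · have h := sum_choose_mul_liftCoeff hs hl hsl
    set u := l + s - n with hu
    have hterm : ∀ d ∈ Finset.range (s + 1), ((n.choose (s - d) : ℝ) * liftCoeff d (n - l)) •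
        Polynomial.derivative^[n - (s - d)] (Polynomial.X ^ (l + d) : Polynomial ℝ) =
        ((n.choose (s - d) : ℝ) * liftCoeff d (n - l) * (l + d).factorial) •
          ((u.factorial : ℝ)⁻¹ • Polynomial.X ^ u) := by
      intro d hd
      have hd' := Finset.mem_range.1 hd
      have hfac := Nat.factorial_mul_descFactorial (show n - (s - d) ≤ l + d by lia)
      rw [show l + d - (n - (s - d)) = u by lia] at hfac
      rw [Polynomial.iterate_derivative_X_pow_eq_smul, show l + d - (n - (s - d)) = u by lia,
        Nat.cast_smul_eq_nsmul, ← Nat.cast_smul_eq_nsmul ℝ, smul_smul, smul_smul, ← hfac]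
      congr 1
      have := u.factorial_ne_zero
      push_cast
      field_simp
    rw [Finset.sum_congr rfl hterm, ← Finset.sum_smul, h, zero_smul]
  · refine Finset.sum_eq_zero fun d hd => ?_
    have hd' := Finset.mem_range.1 hd
    rw [Polynomial.iterate_derivative_X_pow_eq_smul, Nat.descFactorial_of_lt (by lia), Nat.cast_zero,
      zero_smul,
      smul_zero]

lemma Hpoly_eq_sum_liftCoeff {lam : ℝ} (hlam : lam ≠ 0) {n i : ℕ} (hi : i < n) (a : ℕ → ℕ → ℝ) :
    Hpoly lam n a i = ∑ k ∈ Finset.range (i + 1), ∑ l ∈ Finset.range n,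
      ((2 * lam) ^ k / (2 * lam) ^ i * a k l * liftCoeff (i - k) (n - l)) •
        Polynomial.X ^ (l + (i - k)) := by
  have hc : (2 * lam) ^ i ≠ 0 := pow_ne_zero _ (mul_ne_zero two_ne_zero hlam)
  rw [Finset.sum_range_succ, Hpoly, add_comm, Finset.smul_sum]
  congr 1
  · refine Finset.sum_congr rfl fun k hk => ?_
    have hk' := Finset.mem_range.1 hk
    obtain ⟨e, he⟩ := Nat.exists_eq_succ_of_ne_zero (show i - k ≠ 0 by lia)
    rw [he, Nat.succ_eq_add_one]
    conv_rhs => rw [show n = (n - (e + 1)) + (e + 1) by lia, Finset.sum_range_add]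
    rw [Finset.sum_eq_zero (s := Finset.range (n - (e + 1))), zero_add, Finset.smul_sum,
      Finset.smul_sum]
    · refine Finset.sum_congr rfl fun j hj => ?_
      have hj' := Finset.mem_range.1 hj
      rw [show n - (e + 1) + (e + 1) - (n - (e + 1) + j) = (e - j) + 1 by lia, liftCoeff_succ,
        Nat.choose_symm (by lia), show n - i + k + j = n - (e + 1) + j by lia,
        show n - (e + 1) + j + (e + 1) = n + j by lia, Nat.add_sub_cancel,
        Polynomial.C_mul', smul_smul, smul_smul]
      congr 1
      have hsign : (-1 : ℝ) ^ (e + (e - j) + 1) = (-1) ^ (j + 1) := neg_one_pow_congr (by grind)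
      rw [hsign]
      field_simp
    · intro l hl
      have hl' := Finset.mem_range.1 hl
      rw [show n - (e + 1) + (e + 1) - l = (n - l - 1) + 1 by lia, liftCoeff_succ,
        Nat.choose_eq_zero_of_lt (by lia)]
      simp
  · refine Finset.sum_congr rfl fun l hl => ?_
    have hl' := Finset.mem_range.1 hl
    rw [Nat.sub_self, liftCoeff_zero (by lia), div_self hc, one_mul, mul_one, add_zero,
      Polynomial.C_mul']

lemma starCoeff_Hpoly {lam : ℝ} (hlam : lam ≠ 0) {n s : ℕ} (hs : s < n) (a : ℕ → ℕ → ℝ) :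
    starCoeff lam n (Hpoly lam n a) s = 0 := by
  have hc : 2 * lam ≠ 0 := mul_ne_zero two_ne_zero hlam
  set F : ℕ → ℕ → Polynomial ℝ := fun k d => ∑ l ∈ Finset.range n,
    ((2 * lam) ^ (n - s + k) * a k l) • ((n.choose (s - k - d) : ℝ) * liftCoeff d (n - l)) •
      Polynomial.derivative^[n - (s - k - d)] (Polynomial.X ^ (l + d) : Polynomial ℝ) with hF
  have hstar : starCoeff lam n (Hpoly lam n a) s =
      ∑ i ∈ Finset.range (s + 1), ∑ k ∈ Finset.range (i + 1), F k (i - k) := by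
    refine Finset.sum_congr rfl fun i hi => ?_
    have hi' := Finset.mem_range.1 hi
    rw [Hpoly_eq_sum_liftCoeff hlam (by lia), Polynomial.iterate_derivative_sum, Finset.smul_sum]
    refine Finset.sum_congr rfl fun k hk => ?_
    have hk' := Finset.mem_range.1 hk
    rw [Polynomial.iterate_derivative_sum, Finset.smul_sum]
    refine Finset.sum_congr rfl fun l _ => ?_
    rw [Polynomial.iterate_derivative_smul, smul_smul, smul_smul,
      show s - k - (i - k) = s - i by lia, show n - (s - i) = n - s + i by lia]
    congr 1
    field_simp
    ring
  rw [hstar, Finset.sum_range_diag_flip]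
  refine Finset.sum_eq_zero fun k hk => ?_
  have hk' := Finset.mem_range.1 hk
  rw [hF, Finset.sum_comm]
  refine Finset.sum_eq_zero fun l hl => ?_
  rw [← Finset.smul_sum, show s + 1 - k = s - k + 1 by lia,
    sum_liftCoeff_smul_iterate_derivative (by lia) (Finset.mem_range.1 hl), smul_zero]

lemma coeff_Hpoly (lam : ℝ) {n k : ℕ} (hk : k < n) (a : ℕ → ℕ → ℝ) (i : ℕ) :
    (Hpoly lam n a i).coeff k = a i k := by
  have hj (j : ℕ) : k ≠ n + j := by lia
  simp only [Hpoly, Polynomial.coeff_add, Polynomial.finsetSum_coeff, Polynomial.coeff_smul,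
    Polynomial.coeff_C_mul, Polynomial.coeff_X_pow, hj, if_false, mul_zero, Finset.sum_const_zero,
    smul_zero, add_zero]
  simp [hk]

lemma starCoeff_sub (lam : ℝ) (n : ℕ) (h h' : ℕ → Polynomial ℝ) (s : ℕ) :
    starCoeff lam n (fun i => h i - h' i) s = starCoeff lam n h s - starCoeff lam n h' s := by
  simp only [starCoeff, Polynomial.iterate_derivative_sub, smul_sub, Finset.sum_sub_distrib]

lemma eq_zero_of_starCoeff_eq_zero {lam : ℝ} (hlam : lam ≠ 0) {n : ℕ} {u : ℕ → Polynomial ℝ}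
    (hu : ∀ s < n, starCoeff lam n u s = 0) (hlow : ∀ i, ∀ k < n, (u i).coeff k = 0) :
    ∀ s < n, u s = 0 := by
  intro s
  induction s using Nat.strong_induction_on with
  | _ s ih =>
    intro hs
    have h := hu s hs
    rw [starCoeff, Finset.sum_range_succ, Finset.sum_eq_zero, zero_add] at h
    · simp only [Nat.sub_self, Nat.choose_zero_right, Nat.cast_one, one_mul, Nat.sub_zero] at h
      have hd := (smul_eq_zero.1 h).resolve_left (pow_ne_zero _ (mul_ne_zero two_ne_zero hlam))
      ext k
      rw [Polynomial.coeff_zero]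
      by_cases hk : k < n
      · exact hlow s k hk
      · have hc := congrArg (fun q => Polynomial.coeff q (k - n)) hd
        simp only [Polynomial.coeff_iterate_derivative, Polynomial.coeff_zero,
          Nat.sub_add_cancel (not_lt.1 hk)] at hc
        refine (smul_eq_zero.1 hc).resolve_left ?_
        exact (Nat.descFactorial_pos.2 (not_lt.1 hk)).ne'
    · intro i hi
      have hi' := Finset.mem_range.1 hi
      rw [ih i hi' (by lia), Polynomial.iterate_derivative_zero, smul_zero]

lemma Hpoly_congr (lam : ℝ) {n i : ℕ} (hi : i < n) {a b : ℕ → ℕ → ℝ}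
    (hab : ∀ j < n, ∀ k < n, a j k = b j k) : Hpoly lam n a i = Hpoly lam n b i := by
  have h1 : ∀ k ∈ Finset.range n, Polynomial.C (a i k) * Polynomial.X ^ k =
      Polynomial.C (b i k) * Polynomial.X ^ k := fun k hk => by
    rw [hab i hi k (Finset.mem_range.1 hk)]
  rw [Hpoly, Hpoly, Finset.sum_congr rfl h1]
  congr 2
  refine Finset.sum_congr rfl fun k hk => ?_
  congr 1
  refine Finset.sum_congr rfl fun j hj => ?_
  have := Finset.mem_range.1 hk
  have := Finset.mem_range.1 hj
  rw [hab k (by lia) _ (by lia)]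

lemma sum_moyal_mem_Nl_iff_exists_Hpoly {lam : ℝ} (hlam : lam ≠ 0) (n : ℕ)
    (h : ℕ → Polynomial ℝ) :
    (∑ i ∈ Finset.range n, moyal lam (toMv (h i)) (X 0 ^ i)) ∈ Nl lam n ↔
      ∃ a : ℕ → ℕ → ℝ, ∀ i ∈ Finset.range n, h i = Hpoly lam n a i := by
  rw [sum_moyal_mem_Nl_iff]
  constructor
  · intro hz
    refine ⟨fun i k => (h i).coeff k, fun i hi => sub_eq_zero.1 ?_⟩
    refine eq_zero_of_starCoeff_eq_zero hlam
      (u := fun i => h i - Hpoly lam n (fun i k => (h i).coeff k) i) (fun s hs => ?_)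
      (fun i k hk => ?_) i (Finset.mem_range.1 hi)
    · rw [starCoeff_sub, hz s hs, starCoeff_Hpoly hlam hs, sub_zero]
    · rw [Polynomial.coeff_sub, coeff_Hpoly lam hk, sub_self]
  · rintro ⟨a, ha⟩ s hs
    rw [← starCoeff_Hpoly hlam hs a]
    refine Finset.sum_congr rfl fun i hi => ?_
    have := Finset.mem_range.1 hi
    rw [ha i (Finset.mem_range.2 (by lia))]

lemma sub_mem_Nl {lam : ℝ} {n : ℕ} {f g : MvPolynomial (Fin 2) ℝ} (hf : f ∈ Nl lam n)
    (hg : g ∈ Jl lam n) : f - g ∈ Nl lam n := by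
  rw [Nl, Set.mem_ofPred_eq, moyal_X_pow_left, mem_Jl_iff] at hf ⊢
  rw [mem_Jl_iff] at hg
  obtain ⟨v, rfl⟩ := hg
  rw [map_sub]
  refine Submodule.sub_mem _ hf ⟨(starX lam ^ n) v, ?_⟩
  rw [← Module.End.mul_apply, ((commute_starX _ _).pow_pow n n).eq, Module.End.mul_apply]

/-- Proposition 3.2: an element h = Σ_{i<n} h_i *_λ x^i with h_i ∈ ℝ[p] lies
in N_l iff there are constants a_{i,k} (0 ≤ i,k ≤ n−1) such that each h_i is given by the
explicit formula `Hpoly`; consequently every residue class in N_l/J_l has a representative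
of this form with the constants a_{i,k} uniquely determined. -/
theorem proposition_3_2 (lam : ℝ) (hlam : lam ≠ 0) (n : ℕ) (hn : 1 ≤ n) :
    (∀ h : ℕ → Polynomial ℝ,
      (∑ i ∈ Finset.range n, moyal lam (toMv (h i)) (X 0 ^ i)) ∈ Nl lam n ↔
        ∃ a : ℕ → ℕ → ℝ, ∀ i ∈ Finset.range n, h i = Hpoly lam n a i) ∧
    (∀ f ∈ Nl lam n, ∃! a : ℕ → ℕ → ℝ,
      (∀ i k : ℕ, n ≤ i ∨ n ≤ k → a i k = 0) ∧
      f - ∑ i ∈ Finset.range n, moyal lam (toMv (Hpoly lam n a i)) (X 0 ^ i) ∈ Jl lam n) := by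
  refine ⟨sum_moyal_mem_Nl_iff_exists_Hpoly hlam n, fun f hf => ?_⟩
  obtain ⟨h, g, hfg⟩ := exists_eq_sum_starX_pow (-lam) n f
  simp only [← moyal_X_pow_right] at hfg
  have hg : moyal lam g (X 0 ^ n) ∈ Jl lam n := ⟨g, rfl⟩
  have hsum : ∑ i ∈ Finset.range n, moyal lam (toMv (h i)) (X 0 ^ i) ∈ Nl lam n := by
    rw [← sub_eq_iff_eq_add.2 hfg]
    exact sub_mem_Nl hf hg
  obtain ⟨b, hb⟩ := (sum_moyal_mem_Nl_iff_exists_Hpoly hlam n h).1 hsum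
  have hcongr (a : ℕ → ℕ → ℝ) :
      f - ∑ i ∈ Finset.range n, moyal lam (toMv (Hpoly lam n a i)) (X 0 ^ i) ∈ Jl lam n ↔
        ∀ i < n, h i = Hpoly lam n a i := by
    simp only [← sub_eq_zero (a := h _)]
    rw [← sum_starX_pow_mem_Jl_iff lam n, hfg, add_sub_right_comm, mem_Jl_iff, mem_Jl_iff,
      Submodule.add_mem_iff_left _ ((mem_Jl_iff _ _ _).1 hg), ← Finset.sum_sub_distrib]
    simp only [toMv_sub, map_sub, moyal_X_pow_right]
  refine ⟨fun i k => if i < n ∧ k < n then b i k else 0, ⟨fun i k hik => if_neg (by lia), ?_⟩, ?_⟩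
  · refine (hcongr _).2 fun i hi => (hb i (Finset.mem_range.2 hi)).trans ?_
    exact Hpoly_congr lam hi fun j hj k hk => (if_pos ⟨hj, hk⟩).symm
  · rintro a ⟨hz, ha⟩
    funext i k
    split_ifs with hik
    · have hi := (hcongr a).1 ha i hik.1
      rw [hb i (Finset.mem_range.2 hik.1)] at hi
      rw [← coeff_Hpoly lam hik.2 a i, ← hi, coeff_Hpoly lam hik.2]
    · exact hz i k (by lia)
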